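/- Let n ∈ ℕ, s ∈ (0,1) and let A be a Young function. Then V^{s,A}(ℝⁿ) is continuously embedded into BMO(ℝⁿ) (i.e., there exists c' > 0 with |u|_{BMO(ℝⁿ)} ≤ c' |u|_{s,A,ℝⁿ} for all u ∈ V^{s,A}(ℝⁿ)) if and only if there exists a constant c > 0 such that A(t) ≥ c t^{n/s} for all t > 0. -/

import Mathlib

open MeasureTheory Metric Set Filter
open scoped ENNReal Topology

noncomputable section

/-- Euclidean space `ℝⁿ`. -/
abbrev Euc (n : ℕ) := EuclideanSpace ℝ (Fin n)

/-- A Young function: convex, left-continuous, vanishing at `0`,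
non-constant on `(0,∞)`, with values in `[0,∞]`. -/
def IsYoung (A : ℝ → ℝ≥0∞) : Prop :=
  A 0 = 0 ∧
  (∀ x y t : ℝ, 0 ≤ x → 0 ≤ y → 0 ≤ t → t ≤ 1 →
      A (t * x + (1 - t) * y) ≤ ENNReal.ofReal t * A x + ENNReal.ofReal (1 - t) * A y) ∧
  (∀ t : ℝ, 0 < t → ContinuousWithinAt A (Set.Iic t) t) ∧
  (∃ t₁ t₂ : ℝ, 0 < t₁ ∧ 0 < t₂ ∧ A t₁ ≠ A t₂)

/-- The right-continuous generalized inverse of a monotone function `A : [0,∞) → [0,∞]`. -/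
def rcInv (A : ℝ → ℝ≥0∞) (v : ℝ≥0∞) : ℝ :=
  sInf {τ : ℝ | 0 ≤ τ ∧ v < A τ}

/-- The Young conjugate `Ã(t) = sup {τ t - A(τ) : τ ≥ 0}`. -/
def youngConj (A : ℝ → ℝ≥0∞) (t : ℝ) : ℝ≥0∞ :=
  ⨆ (τ : ℝ) (_ : 0 ≤ τ), ENNReal.ofReal (τ * t) - A τ

/-- The functional `J_{σ,A}(v)` for a vector-valued `v`, with the Euclidean norm. -/
def Jfun (n : ℕ) (σ : ℝ) (A : ℝ → ℝ≥0∞) {ι : Type} [Fintype ι]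
    (v : Euc n → ι → ℝ) : ℝ≥0∞ :=
  ∫⁻ x : Euc n, ∫⁻ y : Euc n,
    A (Real.sqrt (∑ i, (v x i - v y i) ^ 2) / ‖x - y‖ ^ σ) /
      ENNReal.ofReal (‖x - y‖ ^ (n : ℝ))

/-- The fractional Orlicz–Sobolev seminorm `|v|_{σ,A,ℝⁿ}` (vector-valued version). -/
def fracSem (n : ℕ) (σ : ℝ) (A : ℝ → ℝ≥0∞) {ι : Type} [Fintype ι]
    (v : Euc n → ι → ℝ) : ℝ≥0∞ :=
  sInf (ENNReal.ofReal '' {lam : ℝ | 0 < lam ∧ Jfun n σ A (fun x i => v x i / lam) ≤ 1})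

/-- The fractional Orlicz–Sobolev seminorm `|u|_{σ,A,ℝⁿ}` of a scalar function. -/
def fracSemS (n : ℕ) (σ : ℝ) (A : ℝ → ℝ≥0∞) (u : Euc n → ℝ) : ℝ≥0∞ :=
  fracSem n σ A (fun x (_ : Fin 1) => u x)

/-- The normalized mean oscillation `φ(|B|^{1/n})⁻¹ ⨍_B |u - u_B|` over the ball `B = B(x,r)`. -/
def oscQuot (n : ℕ) (φ : ℝ → ℝ) (u : Euc n → ℝ) (x : Euc n) (r : ℝ) : ℝ :=
  (φ ((volume (ball x r)).toReal ^ ((n : ℝ)⁻¹)))⁻¹ *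
    ⨍ y in ball x r, |u y - ⨍ z in ball x r, u z|

/-- The Campanato seminorm `|u|_{𝓛^φ(ℝⁿ)}`. -/
def campSem (n : ℕ) (φ : ℝ → ℝ) (u : Euc n → ℝ) : ℝ≥0∞ :=
  ⨆ (x : Euc n) (r : ℝ) (_ : 0 < r), ENNReal.ofReal (oscQuot n φ u x r)

/-- The Campanato quantity restricted to balls of measure at most `r`. -/
def campSemSmall (n : ℕ) (φ : ℝ → ℝ) (u : Euc n → ℝ) (r : ℝ) : ℝ≥0∞ :=
  ⨆ (x : Euc n) (ρ : ℝ) (_ : 0 < ρ) (_ : volume (ball x ρ) ≤ ENNReal.ofReal r),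
    ENNReal.ofReal (oscQuot n φ u x ρ)

/-- `φ : (0,∞) → (0,∞)` is admissible: positive and bounded below away from zero on `[a,∞)`. -/
def Admissible (φ : ℝ → ℝ) : Prop :=
  (∀ r : ℝ, 0 < r → 0 < φ r) ∧
  ∀ a : ℝ, 0 < a → ∃ ε : ℝ, 0 < ε ∧ ∀ r : ℝ, a ≤ r → ε ≤ φ r

/-- `φ_{s,A}(r) = r^s A⁻¹(r^{-n})`. -/
def phiSA (n : ℕ) (s : ℝ) (A : ℝ → ℝ≥0∞) (r : ℝ) : ℝ :=
  r ^ s * rcInv A (ENNReal.ofReal (r ^ (-(n : ℝ))))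

/-- `u` is `m`-times weakly differentiable, with iterated weak partial
derivatives recorded by `D`. -/
def HasWeakDerivs (n m : ℕ) (u : Euc n → ℝ)
    (D : (h : ℕ) → Euc n → (Fin h → Fin n) → ℝ) : Prop :=
  (∀ x d, D 0 x d = u x) ∧
  ∀ h : ℕ, h ≤ m → ∀ dirs : Fin h → Fin n,
    LocallyIntegrable (fun x => D h x dirs) volume ∧
    ∀ φ : Euc n → ℝ, ContDiff ℝ (⊤ : ℕ∞) φ → HasCompactSupport φ →
      ∫ x : Euc n, u x *
          iteratedFDeriv ℝ h φ x (fun i => EuclideanSpace.single (dirs i) (1 : ℝ)) =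
        (-1 : ℝ) ^ h * ∫ x : Euc n, D h x dirs * φ x

/-- The Euclidean length `|∇^h u|(x)` of the `h`-th order weak gradient. -/
def gradLen (n : ℕ) (D : (h : ℕ) → Euc n → (Fin h → Fin n) → ℝ) (h : ℕ) (x : Euc n) : ℝ :=
  Real.sqrt (∑ d : Fin h → Fin n, (D h x d) ^ 2)

/-- The derivatives of orders `k, …, m` decay near infinity:
`|{|∇^h u| > t}| < ∞` for every `t > 0`. -/
def DecayFrom (n k m : ℕ) (D : (h : ℕ) → Euc n → (Fin h → Fin n) → ℝ) : Prop :=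
  ∀ h : ℕ, k ≤ h → h ≤ m → ∀ t : ℝ, 0 < t →
    volume {x : Euc n | t < gradLen n D h x} < ⊤

/-- The Young function `F_k(t) = t^{n/(n-s+k+1)} ∫_0^t Ã(τ) τ^{-1-n/(n-s+k+1)} dτ`. -/
def Fk (n : ℕ) (s : ℝ) (k : ℕ) (A : ℝ → ℝ≥0∞) (t : ℝ) : ℝ≥0∞ :=
  ENNReal.ofReal (t ^ ((n : ℝ) / ((n : ℝ) - s + (k : ℝ) + 1))) *
    ∫⁻ τ in Set.Ioc (0 : ℝ) t,
      youngConj A τ * ENNReal.ofReal (τ ^ (-1 - (n : ℝ) / ((n : ℝ) - s + (k : ℝ) + 1)))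

/-- `ψ^k_{s,A}(r) = 1 / (r^{n-s+k} F_k⁻¹(r^{-n}))`. -/
def psiK (n : ℕ) (s : ℝ) (k : ℕ) (A : ℝ → ℝ≥0∞) (r : ℝ) : ℝ :=
  (r ^ ((n : ℝ) - s + (k : ℝ)) * rcInv (Fk n s k A) (ENNReal.ofReal (r ^ (-(n : ℝ)))))⁻¹

/-- `ψ^{[s]}_{s,A}(r) = r^{{s}} A⁻¹(r^{-n})`. -/
def psiTop (n : ℕ) (s : ℝ) (A : ℝ → ℝ≥0∞) (r : ℝ) : ℝ :=
  r ^ (s - (⌊s⌋₊ : ℝ)) * rcInv A (ENNReal.ofReal (r ^ (-(n : ℝ))))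

/-- Convergence near zero of `∫_0 (t/A(t))^{(s-(k+1))/(n-(s-(k+1)))} dt`. -/
def IntCondK (n : ℕ) (s : ℝ) (k : ℕ) (A : ℝ → ℝ≥0∞) : Prop :=
  ∃ ε : ℝ, 0 < ε ∧
    ∫⁻ t in Set.Ioc (0 : ℝ) ε,
      (ENNReal.ofReal t / A t) ^ ((s - (k : ℝ) - 1) / ((n : ℝ) - (s - (k : ℝ) - 1))) < ⊤

/-- `P` is the projection polynomial `P^k_B[u]`: it has degree at most `k` and its
derivatives up to order `k` match, in the mean over `B`, the weak derivatives `D` of `u`. -/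
def IsCampPoly (n k : ℕ) (D : (h : ℕ) → Euc n → (Fin h → Fin n) → ℝ)
    (B : Set (Euc n)) (P : MvPolynomial (Fin n) ℝ) : Prop :=
  P.totalDegree ≤ k ∧
  ∀ h : ℕ, h ≤ k → ∀ dirs : Fin h → Fin n,
    ∫ x in B, D h x dirs =
      ∫ x in B,
        iteratedFDeriv ℝ h (fun y : Euc n => MvPolynomial.eval (fun i => y i) P) x
          (fun i => EuclideanSpace.single (dirs i) (1 : ℝ))

/-- The normalized oscillation of order `k` over the ball `B(x,r)`. -/
def oscQuotK (n k : ℕ) (φ : ℝ → ℝ) (u : Euc n → ℝ)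
    (D : (h : ℕ) → Euc n → (Fin h → Fin n) → ℝ) (x : Euc n) (r : ℝ) : ℝ≥0∞ :=
  ⨅ (P : MvPolynomial (Fin n) ℝ) (_ : IsCampPoly n k D (ball x r) P),
    ENNReal.ofReal
      ((φ ((volume (ball x r)).toReal ^ ((n : ℝ)⁻¹)) *
          (volume (ball x r)).toReal ^ ((k : ℝ) / (n : ℝ)))⁻¹ *
        ⨍ y in ball x r, |u y - MvPolynomial.eval (fun i => y i) P|)

/-- The `k`-th order Campanato seminorm `|u|_{𝓛^{k,φ}(ℝⁿ)}`. -/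
def campSemK (n k : ℕ) (φ : ℝ → ℝ) (u : Euc n → ℝ)
    (D : (h : ℕ) → Euc n → (Fin h → Fin n) → ℝ) : ℝ≥0∞ :=
  ⨆ (x : Euc n) (r : ℝ) (_ : 0 < r), oscQuotK n k φ u D x r

/-- The `k`-th order Campanato quantity restricted to balls of measure at most `r`. -/
def campSemKSmall (n k : ℕ) (φ : ℝ → ℝ) (u : Euc n → ℝ)
    (D : (h : ℕ) → Euc n → (Fin h → Fin n) → ℝ) (r : ℝ) : ℝ≥0∞ :=
  ⨆ (x : Euc n) (ρ : ℝ) (_ : 0 < ρ) (_ : volume (ball x ρ) ≤ ENNReal.ofReal r),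
    oscQuotK n k φ u D x ρ

/-- The Luxemburg norm `‖f‖_{L^A(μ)}`. -/
def luxNorm {α : Type*} [MeasurableSpace α] (A : ℝ → ℝ≥0∞) (μ : Measure α)
    (f : α → ℝ) : ℝ≥0∞ :=
  sInf (ENNReal.ofReal '' {lam : ℝ | 0 < lam ∧ ∫⁻ x, A (|f x| / lam) ∂μ ≤ 1})

/-- Iterated integral `∫_r^∞ ∫_{r_1}^∞ ⋯ g`. -/
def iterInt : ℕ → (ℝ → ℝ) → (ℝ → ℝ)
  | 0, g => g
  | j + 1, g => fun r => ∫ t in Set.Ioi r, iterInt j g t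

end

theorem IsYoung.map_mul_le {A : ℝ → ℝ≥0∞} (hA : IsYoung A) {q κ : ℝ} (hq0 : 0 ≤ q) (hq1 : q ≤ 1)
    (hκ : 0 ≤ κ) : A (q * κ) ≤ ENNReal.ofReal q * A κ := by
  simpa [hA.1] using hA.2.1 κ 0 q hκ le_rfl hq0 hq1

theorem ofReal_meanOscillation_le {α : Type*} [MeasurableSpace α] (ν : Measure α)
    [IsProbabilityMeasure ν] {u : α → ℝ} (hm : AEStronglyMeasurable u ν) :
    ENNReal.ofReal (∫ y, |u y - ∫ z, u z ∂ν| ∂ν) ≤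
      ∫⁻ y, ∫⁻ z, ENNReal.ofReal |u y - u z| ∂ν ∂ν := by
  by_cases hu : Integrable u ν
  · have h1 : Integrable (fun y => |u y - ∫ z, u z ∂ν|) ν :=
      (hu.sub (integrable_const _)).abs
    rw [ofReal_integral_eq_lintegral_ofReal h1 (Eventually.of_forall fun _ => abs_nonneg _)]
    refine lintegral_mono fun y => ?_
    have h2 : u y - ∫ z, u z ∂ν = ∫ z, (u y - u z) ∂ν := by
      rw [integral_sub (integrable_const _) hu]; simp
    simp only [h2, ← Real.enorm_eq_ofReal_abs]
    exact enorm_integral_le_lintegral_enorm _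
  · have h0 : ∫ z, u z ∂ν = 0 := integral_undef hu
    have h1 : ∫ y, |u y - ∫ z, u z ∂ν| ∂ν = 0 := by
      simp only [h0, sub_zero]
      exact integral_undef fun h => hu ((integrable_norm_iff hm).1 h)
    simp [h1]

theorem lintegral_rpow_le_of_isProbabilityMeasure {α : Type*} [MeasurableSpace α] (ν : Measure α)
    [IsProbabilityMeasure ν] {f : α → ℝ≥0∞} (hf : AEMeasurable f ν) {p : ℝ} (hp : 1 ≤ p) :
    ∫⁻ x, f x ∂ν ≤ (∫⁻ x, f x ^ p ∂ν) ^ (1 / p) := by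
  have := eLpNorm'_le_eLpNorm'_of_exponent_le (ε := ℝ≥0∞) one_pos hp ν hf.aestronglyMeasurable
  simpa [eLpNorm'] using this

theorem Jfun_fin_one (n : ℕ) (s : ℝ) (A : ℝ → ℝ≥0∞) (u : Euc n → ℝ) (lam : ℝ) :
    Jfun n s A (fun x (_ : Fin 1) => u x / lam) =
      ∫⁻ x : Euc n, ∫⁻ y : Euc n, A (|u x / lam - u y / lam| / ‖x - y‖ ^ s) /
        ENNReal.ofReal (‖x - y‖ ^ (n : ℝ)) := by
  simp [Jfun, Real.sqrt_sq_eq_abs]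

theorem ofReal_rpow_le_mul_of_le {n : ℕ} {s : ℝ} (hs : 0 < s) {A : ℝ → ℝ≥0∞} {c : ℝ} (hc : 0 < c)
    (hn : 0 < n)
    (hA : ∀ t : ℝ, 0 < t → ENNReal.ofReal (c * t ^ ((n : ℝ) / s)) ≤ A t)
    {a ρ R : ℝ} (ha : 0 ≤ a) (hρ : 0 ≤ ρ) (hρR : ρ ≤ R) (h0 : ρ = 0 → a = 0) :
    ENNReal.ofReal (a ^ ((n : ℝ) / s)) ≤ ENNReal.ofReal (c⁻¹ * (R ^ n) ^ 2) *
      (A (a / ρ ^ s) / ENNReal.ofReal (ρ ^ (n : ℝ))) := by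
  have hp : 0 < (n : ℝ) / s := by positivity
  rcases ha.eq_or_lt with rfl | ha
  · simp [Real.zero_rpow hp.ne']
  have hρ : 0 < ρ := hρ.lt_of_ne fun h => ha.ne' (h0 h.symm)
  have ht : 0 < a / ρ ^ s := by positivity
  grw [← hA _ ht]
  rw [← ENNReal.ofReal_div_of_pos (by positivity), ← ENNReal.ofReal_mul (by positivity)]
  refine ENNReal.ofReal_le_ofReal ?_
  rw [Real.div_rpow ha.le (by positivity), ← Real.rpow_mul hρ.le, mul_div_cancel₀ _ hs.ne',
    Real.rpow_natCast]
  have h1 : ρ ^ n ≤ R ^ n := pow_le_pow_left₀ hρ.le hρR n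
  have h2 : 0 < ρ ^ n := by positivity
  have h3 : c⁻¹ * (R ^ n) ^ 2 * (c * (a ^ ((n : ℝ) / s) / ρ ^ n) / ρ ^ n) =
      a ^ ((n : ℝ) / s) * ((R ^ n) / ρ ^ n) ^ 2 := by
    field_simp
  rw [h3]
  have h4 : 1 ≤ R ^ n / ρ ^ n := (one_le_div h2).2 h1
  exact le_mul_of_one_le_right (by positivity) (one_le_pow₀ h4)

theorem ofReal_average_oscillation_le {n : ℕ} (hn : 0 < n) {s : ℝ} (hs : s ∈ Ioo (0 : ℝ) 1)
    {A : ℝ → ℝ≥0∞} {c : ℝ} (hc : 0 < c)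
    (hA : ∀ t : ℝ, 0 < t → ENNReal.ofReal (c * t ^ ((n : ℝ) / s)) ≤ A t)
    {u : Euc n → ℝ} (hu : Measurable u) {lam : ℝ} (hlam : 0 < lam)
    (hJ : Jfun n s A (fun x (_ : Fin 1) => u x / lam) ≤ 1) (x : Euc n) {r : ℝ} (hr : 0 < r) :
    ENNReal.ofReal (⨍ y in ball x r, |u y - ⨍ z in ball x r, u z|) ≤
      ENNReal.ofReal (c⁻¹ * (4 ^ n) * ((volume (ball (0 : Euc n) 1)).toReal⁻¹) ^ 2)
        ^ (s / (n : ℝ)) * ENNReal.ofReal lam := by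
  have hn' : (0 : ℝ) < n := Nat.cast_pos.2 hn
  have hp : 1 ≤ (n : ℝ) / s := by
    rw [le_div_iff₀ hs.1, one_mul]
    exact hs.2.le.trans (by exact_mod_cast hn)
  set B := ball x r
  have hB0 : volume B ≠ 0 := (measure_ball_pos volume x hr).ne'
  have hBt : volume B ≠ ⊤ := measure_ball_lt_top.ne
  set ν : Measure (Euc n) := (volume B)⁻¹ • volume.restrict B with hν
  have hνp : IsProbabilityMeasure ν := ⟨by
    simp [hν, ENNReal.inv_mul_cancel hB0 hBt]⟩
  have hav : ∀ f : Euc n → ℝ, ⨍ y in B, f y = ∫ y, f y ∂ν := fun f => by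
    rw [average, Measure.restrict_apply_univ]
  have hs0 := hs.1
  simp only [hav]
  refine (ofReal_meanOscillation_le ν hu.aestronglyMeasurable).trans ?_
  set p := (n : ℝ) / s with hpdef
  set a : Euc n → Euc n → ℝ := fun y z => |u y / lam - u z / lam| with ha
  have ham : Measurable (fun w : Euc n × Euc n => a w.1 w.2) := by fun_prop
  have hsplit : ∀ y z, ENNReal.ofReal |u y - u z| =
      ENNReal.ofReal lam * ENNReal.ofReal (a y z) := fun y z => by
    rw [← ENNReal.ofReal_mul hlam.le, ha]
    simp only
    rw [← sub_div, abs_div, abs_of_pos hlam, mul_div_cancel₀ _ hlam.ne']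
  have hinner : ∫⁻ y, ∫⁻ z, ENNReal.ofReal |u y - u z| ∂ν ∂ν =
      ENNReal.ofReal lam * ∫⁻ w, ENNReal.ofReal (a w.1 w.2) ∂(ν.prod ν) := by
    rw [← lintegral_const_mul _ ham.ennreal_ofReal,
      lintegral_prod _ (by fun_prop)]
    simp only [hsplit]
  rw [hinner, mul_comm]
  gcongr
  refine (lintegral_rpow_le_of_isProbabilityMeasure (ν.prod ν)
    ham.ennreal_ofReal.aemeasurable hp).trans ?_
  rw [hpdef, one_div_div]
  gcongr
  rw [lintegral_prod _ (by fun_prop)]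
  have hbound : ∀ y ∈ B, ∀ z ∈ B, ENNReal.ofReal (a y z) ^ p ≤
      ENNReal.ofReal (c⁻¹ * ((2 * r) ^ n) ^ 2) *
        (A (a y z / ‖y - z‖ ^ s) / ENNReal.ofReal (‖y - z‖ ^ (n : ℝ))) := fun y hy z hz => by
    rw [ENNReal.ofReal_rpow_of_nonneg (abs_nonneg _) (by positivity)]
    refine ofReal_rpow_le_mul_of_le hs.1 hc hn hA (abs_nonneg _) (norm_nonneg _) ?_ ?_
    · rw [← dist_eq_norm]
      have := dist_triangle_right y z x
      have h1 := mem_ball.1 hy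
      have h2 := mem_ball.1 hz
      linarith
    · intro h
      rw [sub_eq_zero.1 (norm_eq_zero.1 h)]
      simp
  set M := ENNReal.ofReal (c⁻¹ * ((2 * r) ^ n) ^ 2) with hM
  have hMt : M ≠ ⊤ := ENNReal.ofReal_ne_top
  calc ∫⁻ y, ∫⁻ z, ENNReal.ofReal (a y z) ^ p ∂ν ∂ν
      = (volume B)⁻¹ * ((volume B)⁻¹ * ∫⁻ y in B, ∫⁻ z in B, ENNReal.ofReal (a y z) ^ p) := by
        simp only [hν, lintegral_smul_measure, smul_eq_mul]
        rw [lintegral_const_mul' _ _ (ENNReal.inv_ne_top.2 hB0)]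
    _ ≤ (volume B)⁻¹ * ((volume B)⁻¹ * ∫⁻ y in B, ∫⁻ z in B, M *
          (A (a y z / ‖y - z‖ ^ s) / ENNReal.ofReal (‖y - z‖ ^ (n : ℝ)))) := by
        refine mul_le_mul' le_rfl (mul_le_mul' le_rfl ?_)
        refine setLIntegral_mono' measurableSet_ball fun y hy => ?_
        exact setLIntegral_mono' measurableSet_ball fun z hz => hbound y hy z hz
    _ ≤ (volume B)⁻¹ * ((volume B)⁻¹ * ∫⁻ y, ∫⁻ z, M *
          (A (a y z / ‖y - z‖ ^ s) / ENNReal.ofReal (‖y - z‖ ^ (n : ℝ)))) := by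
        refine mul_le_mul' le_rfl (mul_le_mul' le_rfl ?_)
        refine (setLIntegral_le_lintegral _ _).trans ?_
        exact lintegral_mono fun y => setLIntegral_le_lintegral _ _
    _ = (volume B)⁻¹ * ((volume B)⁻¹ * (M * Jfun n s A (fun x (_ : Fin 1) => u x / lam))) := by
        simp only [lintegral_const_mul' _ _ hMt, Jfun_fin_one, ha]
    _ ≤ (volume B)⁻¹ * ((volume B)⁻¹ * (M * 1)) := by gcongr
    _ = _ := by
        have hω : 0 < (volume (ball (0 : Euc n) 1)).toReal :=
          ENNReal.toReal_pos (measure_ball_pos volume _ one_pos).ne' measure_ball_lt_top.ne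
        have hv : volume B = ENNReal.ofReal (r ^ n * (volume (ball (0 : Euc n) 1)).toReal) := by
          rw [Measure.addHaar_ball_of_pos _ _ hr, ENNReal.ofReal_mul (by positivity),
            ENNReal.ofReal_toReal measure_ball_lt_top.ne, finrank_euclideanSpace_fin]
        rw [hv, hM, ← ENNReal.ofReal_inv_of_pos (by positivity), mul_one,
          ← ENNReal.ofReal_mul (by positivity), ← ENNReal.ofReal_mul (by positivity)]
        congr 1
        have h4 : (4 : ℝ) ^ n = (2 ^ n) ^ 2 := by rw [← pow_mul, mul_comm, pow_mul]; norm_num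
        rw [h4, mul_pow]
        field_simp

theorem campSem_le_of_rpow_le {n : ℕ} (hn : 0 < n) {s : ℝ} (hs : s ∈ Ioo (0 : ℝ) 1)
    {A : ℝ → ℝ≥0∞} {c : ℝ} (hc : 0 < c)
    (hA : ∀ t : ℝ, 0 < t → ENNReal.ofReal (c * t ^ ((n : ℝ) / s)) ≤ A t) :
    ∃ c' : ℝ, 0 < c' ∧ ∀ u : Euc n → ℝ, Measurable u →
      campSem n (fun _ => 1) u ≤ ENNReal.ofReal c' * fracSemS n s A u := by
  have hs0 := hs.1
  have hω : 0 < (volume (ball (0 : Euc n) 1)).toReal :=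
    ENNReal.toReal_pos (measure_ball_pos volume _ one_pos).ne' measure_ball_lt_top.ne
  refine ⟨(c⁻¹ * (4 ^ n) * ((volume (ball (0 : Euc n) 1)).toReal⁻¹) ^ 2) ^ (s / (n : ℝ)),
    by positivity, fun u hu => ?_⟩
  rw [← ENNReal.ofReal_rpow_of_nonneg (by positivity) (by positivity)]
  set C := ENNReal.ofReal (c⁻¹ * (4 ^ n) * ((volume (ball (0 : Euc n) 1)).toReal⁻¹) ^ 2)
    ^ (s / (n : ℝ)) with hC
  have hCt : C ≠ ⊤ := ENNReal.rpow_ne_top_of_nonneg (by positivity) ENNReal.ofReal_ne_top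
  have hC0 : C ≠ 0 := by
    have : 0 < c⁻¹ * (4 ^ n) * ((volume (ball (0 : Euc n) 1)).toReal⁻¹) ^ 2 := by positivity
    exact (ENNReal.rpow_pos (ENNReal.ofReal_pos.2 this) ENNReal.ofReal_ne_top).ne'
  rw [← ENNReal.div_le_iff' hC0 hCt]
  refine le_sInf ?_
  rintro _ ⟨lam, ⟨hlam, hJ⟩, rfl⟩
  rw [ENNReal.div_le_iff' hC0 hCt]
  refine iSup_le fun x => iSup_le fun r => iSup_le fun hr => ?_
  have := ofReal_average_oscillation_le hn hs hc hA hu hlam hJ x hr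
  simpa only [oscQuot, inv_one, one_mul] using this

/-- The Lipschitz bump supported in the ball of radius `r` about the origin. -/
noncomputable def tent (n : ℕ) (r : ℝ) (x : Euc n) : ℝ := max 0 (1 - ‖x‖ / r)

theorem continuous_tent (n : ℕ) (r : ℝ) : Continuous (tent n r) := by
  unfold tent; fun_prop

theorem tent_nonneg (n : ℕ) (r : ℝ) (x : Euc n) : 0 ≤ tent n r x := le_max_left _ _

theorem tent_le_one {n : ℕ} {r : ℝ} (hr : 0 < r) (x : Euc n) : tent n r x ≤ 1 :=
  max_le zero_le_one (by have : 0 ≤ ‖x‖ / r := by positivity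
                         linarith)

theorem tent_eq_zero {n : ℕ} {r : ℝ} (hr : 0 < r) {x : Euc n} (hx : r ≤ ‖x‖) :
    tent n r x = 0 :=
  max_eq_left (by have := (one_le_div hr).2 hx
                  linarith)

theorem half_le_tent {n : ℕ} {r : ℝ} (hr : 0 < r) {x : Euc n} (hx : ‖x‖ ≤ r / 2) :
    1 / 2 ≤ tent n r x := by
  refine le_max_of_le_right ?_
  have : ‖x‖ / r ≤ 1 / 2 := by
    rw [div_le_iff₀ hr]; linarith
  linarith

theorem abs_tent_sub_le {n : ℕ} {r : ℝ} (hr : 0 < r) (x y : Euc n) :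
    |tent n r x - tent n r y| ≤ min 1 (‖x - y‖ / r) := by
  refine le_min ?_ ?_
  · rw [abs_sub_le_iff]
    constructor <;> linarith [tent_nonneg n r x, tent_nonneg n r y, tent_le_one hr x,
      tent_le_one hr y]
  · unfold tent
    rw [max_comm 0, max_comm 0]
    refine (abs_max_sub_max_le_abs _ _ _).trans ?_
    have : 1 - ‖x‖ / r - (1 - ‖y‖ / r) = (‖y‖ - ‖x‖) / r := by ring
    rw [this, abs_div, abs_of_pos hr, norm_sub_rev]
    gcongr
    exact abs_norm_sub_norm_le y x

theorem oscQuot_tent_ge {n : ℕ} (hn : 0 < n) {r : ℝ} (hr : 0 < r) :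
    (1 / 4 : ℝ) ^ n / 4 ≤ oscQuot n (fun _ => 1) (tent n r) 0 (2 * r) := by
  unfold oscQuot
  rw [inv_one, one_mul]
  generalize ⨍ z in ball (0 : Euc n) (2 * r), tent n r z = m
  set ω := volume.real (ball (0 : Euc n) 1) with hωdef
  have hω : 0 < ω :=
    ENNReal.toReal_pos (measure_ball_pos volume _ one_pos).ne' measure_ball_lt_top.ne
  have hvol : ∀ R : ℝ, 0 < R → volume.real (ball (0 : Euc n) R) = R ^ n * ω := fun R hR => by
    rw [measureReal_def, Measure.addHaar_ball_of_pos _ _ hR, ENNReal.toReal_mul,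
      ENNReal.toReal_ofReal (by positivity), finrank_euclideanSpace_fin, hωdef, measureReal_def]
  have hint : IntegrableOn (fun y => |tent n r y - m|) (ball (0 : Euc n) (2 * r)) := by
    have hc : Continuous fun y => |tent n r y - m| :=
      ((continuous_tent n r).sub continuous_const).abs
    exact (hc.continuousOn.integrableOn_compact
      (isCompact_closedBall (0 : Euc n) (2 * r))).mono_set ball_subset_closedBall
  have hkey : ∀ S ⊆ ball (0 : Euc n) (2 * r), MeasurableSet S →
      (r / 2) ^ n * ω ≤ volume.real S → (∀ y ∈ S, 1 / 4 ≤ |tent n r y - m|) →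
      (1 / 4 : ℝ) ^ n / 4 ≤ ⨍ y in ball (0 : Euc n) (2 * r), |tent n r y - m| := by
    intro S hS hSm hSv hle
    have hSt : volume S ≠ ⊤ := ((measure_mono hS).trans_lt measure_ball_lt_top).ne
    have h1 : 1 / 4 * volume.real S ≤ ∫ y in ball (0 : Euc n) (2 * r), |tent n r y - m| :=
      (setIntegral_ge_of_const_le_real hSm hSt hle (hint.mono_set hS)).trans
        (setIntegral_mono_set hint (Eventually.of_forall fun _ => abs_nonneg _)
          hS.eventuallyLE)
    rw [setAverage_eq, smul_eq_mul, hvol _ (by positivity), inv_mul_eq_div,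
      le_div_iff₀ (by positivity)]
    refine le_trans (le_of_eq ?_) ((mul_le_mul_of_nonneg_left hSv (by norm_num)).trans h1)
    rw [show r / 2 = 1 / 4 * (2 * r) by ring, mul_pow (1 / 4)]
    ring
  rcases le_total (1 / 4) |m| with hm | hm
  · refine hkey (ball 0 (2 * r) \ ball 0 r) sdiff_subset
      (measurableSet_ball.diff measurableSet_ball) ?_ fun y hy => ?_
    · rw [measureReal_sdiff (ball_subset_ball (by linarith)) measurableSet_ball
        measure_ball_lt_top.ne, hvol _ hr, hvol _ (by positivity), ← sub_mul]
      gcongr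
      have h1 : (r / 2) ^ n ≤ r ^ n := pow_le_pow_left₀ (by positivity) (by linarith) n
      have h2 : (2 : ℝ) ≤ 2 ^ n := le_self_pow₀ (by norm_num) hn.ne'
      have h3 : 0 < r ^ n := by positivity
      rw [mul_pow]
      nlinarith
    · have : r ≤ ‖y‖ := by simpa using hy.2
      rw [tent_eq_zero hr this, zero_sub, abs_neg]
      exact hm
  · refine hkey (ball 0 (r / 2)) (ball_subset_ball (by linarith)) measurableSet_ball
      (hvol _ (by positivity)).ge fun y hy => ?_
    have h1 : 1 / 2 ≤ tent n r y := half_le_tent hr (mem_ball_zero_iff.1 hy).le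
    have h2 := le_abs_self m
    exact le_trans (by linarith) (le_abs_self _)

/-- The radial kernel controlling the fractional difference quotients of `tent n r`. -/
noncomputable def tentKernel (n : ℕ) (s r : ℝ) (z : Euc n) : ℝ :=
  min 1 (‖z‖ / r) * (‖z‖ / r) ^ (-s) * ‖z‖ ^ (-(n : ℝ))

theorem tentKernel_nonneg {n : ℕ} {s r : ℝ} (hr : 0 < r) (z : Euc n) : 0 ≤ tentKernel n s r z := by
  unfold tentKernel; positivity

theorem measurable_tentKernel (n : ℕ) (s r : ℝ) : Measurable (tentKernel n s r) := by
  unfold tentKernel; fun_prop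

theorem integrable_tentKernel_one {n : ℕ} (hn : 0 < n) {s : ℝ} (hs : s ∈ Ioo (0 : ℝ) 1) :
    Integrable (tentKernel n s 1) := by
  have : Nonempty (Fin n) := ⟨⟨0, hn⟩⟩
  have h := integrable_fun_norm_addHaar (volume : Measure (Euc n))
    (f := fun ρ : ℝ => min 1 (ρ / 1) * (ρ / 1) ^ (-s) * ρ ^ (-(n : ℝ)))
  refine h.2 ?_
  rw [finrank_euclideanSpace_fin]
  have hpow : ∀ ρ : ℝ, 0 < ρ →
      ρ ^ (n - 1) • (min 1 (ρ / 1) * (ρ / 1) ^ (-s) * ρ ^ (-(n : ℝ))) =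
        min 1 ρ * ρ ^ (-s - 1) := fun ρ hρ => by
    have h1 : ρ ^ (n - 1) = ρ ^ ((n : ℝ) - 1) := by
      rw [← Real.rpow_natCast, Nat.cast_pred hn]
    have h2 : ρ ^ (-s - 1) = ρ ^ ((n : ℝ) - 1) * (ρ ^ (-s) * ρ ^ (-(n : ℝ))) := by
      rw [← Real.rpow_add hρ, ← Real.rpow_add hρ]; congr 1; ring
    rw [h1, h2, smul_eq_mul, div_one]; ring
  rw [← Ioc_union_Ioi_eq_Ioi zero_le_one, integrableOn_union]
  constructor
  · have h3 : IntegrableOn (fun ρ : ℝ => ρ ^ (-s)) (Ioc 0 1) :=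
      (intervalIntegrable_iff_integrableOn_Ioc_of_le zero_le_one).1
        (intervalIntegral.intervalIntegrable_rpow' (by linarith [hs.2]))
    refine h3.congr_fun (fun ρ hρ => ?_) measurableSet_Ioc
    rw [hpow ρ hρ.1, min_eq_right hρ.2]
    rw [Real.rpow_sub_one hρ.1.ne', mul_div_cancel₀ _ hρ.1.ne']
  · have h3 : IntegrableOn (fun ρ : ℝ => ρ ^ (-s - 1)) (Ioi 1) :=
      integrableOn_Ioi_rpow_of_lt (by linarith [hs.1]) one_pos
    refine h3.congr_fun (fun ρ hρ => ?_) measurableSet_Ioi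
    have hρ' : (1 : ℝ) < ρ := hρ
    rw [hpow ρ (by linarith), min_eq_left hρ'.le, one_mul]

theorem exists_lintegral_tentKernel_le {n : ℕ} (hn : 0 < n) {s : ℝ} (hs : s ∈ Ioo (0 : ℝ) 1) :
    ∃ K : ℝ, 0 < K ∧ ∀ r : ℝ, 0 < r →
      ∫⁻ z, ENNReal.ofReal (tentKernel n s r z) ≤ ENNReal.ofReal K := by
  have h1 := integrable_tentKernel_one hn hs
  have h0 : 0 ≤ ∫ z, tentKernel n s 1 z := integral_nonneg fun z => tentKernel_nonneg one_pos z
  refine ⟨(∫ z, tentKernel n s 1 z) + 1, by positivity, fun r hr => ?_⟩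
  have hscale : tentKernel n s r = fun z => (r ^ n)⁻¹ * tentKernel n s 1 (r⁻¹ • z) := by
    funext z
    unfold tentKernel
    have h2 : ‖z‖ ^ (-(n : ℝ)) = (r ^ n)⁻¹ * (‖z‖ / r) ^ (-(n : ℝ)) := by
      rw [Real.div_rpow (norm_nonneg _) hr.le, Real.rpow_neg hr.le, Real.rpow_natCast]
      field_simp
    rw [norm_smul, norm_inv, Real.norm_of_nonneg hr.le, div_one, inv_mul_eq_div r, h2]
    ring
  have hint : Integrable (tentKernel n s r) := by
    rw [hscale]
    exact ((integrable_comp_smul_iff volume _ (inv_ne_zero hr.ne')).2 h1).const_mul _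
  rw [← ofReal_integral_eq_lintegral_ofReal hint
    (Eventually.of_forall fun z => tentKernel_nonneg hr z)]
  refine ENNReal.ofReal_le_ofReal ?_
  rw [hscale, integral_const_mul, Measure.integral_comp_inv_smul_of_nonneg _ _ hr.le,
    finrank_euclideanSpace_fin, smul_eq_mul, ← mul_assoc, inv_mul_cancel₀ (by positivity), one_mul]
  linarith

theorem tent_integrand_le {n : ℕ} {s : ℝ} (hs : s ∈ Ioo (0 : ℝ) 1)
    {A : ℝ → ℝ≥0∞} (hA : IsYoung A) {r lam : ℝ} (hr : 0 < r) (hlam : 0 < lam) (x y : Euc n) :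
    A (|tent n r x / lam - tent n r y / lam| / ‖x - y‖ ^ s) /
        ENNReal.ofReal (‖x - y‖ ^ (n : ℝ)) ≤
      A (r ^ (-s) / lam) *
        ((ball 0 r).indicator 1 x * ENNReal.ofReal (tentKernel n s r (x - y)) +
          (ball 0 r).indicator 1 y * ENNReal.ofReal (tentKernel n s r (x - y))) := by
  rcases eq_or_ne x y with rfl | hxy
  · simp [hA.1]
  have hρ : 0 < ‖x - y‖ := norm_pos_iff.2 (sub_ne_zero.2 hxy)
  set ρ := ‖x - y‖ with hρdef
  set d := |tent n r x - tent n r y| with hd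
  have hdle : d ≤ min 1 (ρ / r) := abs_tent_sub_le hr x y
  have hd0 : 0 ≤ d := abs_nonneg _
  have hq : |tent n r x / lam - tent n r y / lam| / ρ ^ s =
      d * (ρ / r) ^ (-s) * (r ^ (-s) / lam) := by
    rw [← sub_div, abs_div, abs_of_pos hlam, ← hd, Real.div_rpow hρ.le hr.le,
      Real.rpow_neg hρ.le]
    have : r ^ (-s) ≠ 0 := by positivity
    field_simp
  have hmin : min 1 (ρ / r) ≤ (ρ / r) ^ s := by
    rcases le_total 1 (ρ / r) with h | h
    · exact (min_le_left _ _).trans (Real.one_le_rpow h hs.1.le)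
    · refine (min_le_right _ _).trans ?_
      simpa using Real.rpow_le_rpow_of_exponent_ge (by positivity) h hs.2.le
  have hq1 : d * (ρ / r) ^ (-s) ≤ 1 := by
    rw [Real.rpow_neg (by positivity), ← div_eq_mul_inv, div_le_one (by positivity)]
    exact hdle.trans hmin
  rw [hq]
  grw [hA.map_mul_le (by positivity) hq1 (by positivity)]
  rw [mul_comm (ENNReal.ofReal _) (A _), mul_div_assoc]
  gcongr
  rw [← ENNReal.ofReal_div_of_pos (by positivity)]
  have hker : ENNReal.ofReal (d * (ρ / r) ^ (-s) / ρ ^ (n : ℝ)) ≤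
      ENNReal.ofReal (tentKernel n s r (x - y)) := by
    refine ENNReal.ofReal_le_ofReal ?_
    unfold tentKernel
    rw [← hρdef, div_eq_mul_inv, ← Real.rpow_neg hρ.le]
    gcongr
  by_cases hx : x ∈ ball (0 : Euc n) r
  · refine le_add_of_le_of_nonneg ?_ zero_le
    simpa [hx] using hker
  by_cases hy : y ∈ ball (0 : Euc n) r
  · refine le_add_of_nonneg_of_le zero_le ?_
    simpa [hy] using hker
  have hd' : d = 0 := by
    rw [hd, tent_eq_zero hr (by simpa using hx), tent_eq_zero hr (by simpa using hy)]
    simp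
  simp [hd']

theorem Jfun_tent_le {n : ℕ} (hn : 0 < n) {s : ℝ} (hs : s ∈ Ioo (0 : ℝ) 1)
    {A : ℝ → ℝ≥0∞} (hA : IsYoung A) :
    ∃ C : ℝ, 0 < C ∧ ∀ r lam : ℝ, 0 < r → 0 < lam →
      Jfun n s A (fun x (_ : Fin 1) => tent n r x / lam) ≤
        A (r ^ (-s) / lam) * ENNReal.ofReal (C * r ^ n) := by
  obtain ⟨K, hK, hKle⟩ := exists_lintegral_tentKernel_le hn hs
  have hω : 0 < (volume (ball (0 : Euc n) 1)).toReal :=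
    ENNReal.toReal_pos (measure_ball_pos volume _ one_pos).ne' measure_ball_lt_top.ne
  refine ⟨2 * K * (volume (ball (0 : Euc n) 1)).toReal, by positivity, fun r lam hr hlam => ?_⟩
  rw [Jfun_fin_one]
  set G : Euc n → ℝ≥0∞ := fun z => ENNReal.ofReal (tentKernel n s r z) with hG
  have hGm : Measurable G := (measurable_tentKernel n s r).ennreal_ofReal
  set I : Euc n → ℝ≥0∞ := (ball 0 r).indicator 1 with hI
  have hIm : Measurable I := measurable_one.indicator measurableSet_ball
  have hIv : ∫⁻ x, I x = volume (ball (0 : Euc n) r) := lintegral_indicator_one measurableSet_ball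
  have hm1 : Measurable fun w : Euc n × Euc n => I w.1 * G (w.1 - w.2) := by fun_prop
  have hm2 : Measurable fun w : Euc n × Euc n => I w.2 * G (w.1 - w.2) := by fun_prop
  have e1 : ∫⁻ x, ∫⁻ y, I x * G (x - y) ≤ volume (ball (0 : Euc n) r) * ENNReal.ofReal K := by
    rw [← hIv, ← lintegral_mul_const _ hIm]
    refine lintegral_mono fun x => ?_
    rw [lintegral_const_mul _ (by fun_prop), lintegral_sub_left_eq_self G x]
    gcongr
    exact hKle r hr
  have e2 : ∫⁻ x, ∫⁻ y, I y * G (x - y) ≤ volume (ball (0 : Euc n) r) * ENNReal.ofReal K := by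
    rw [lintegral_lintegral_swap hm2.aemeasurable, ← hIv, ← lintegral_mul_const _ hIm]
    refine lintegral_mono fun y => ?_
    rw [lintegral_const_mul _ (by fun_prop), lintegral_sub_right_eq_self G y]
    gcongr
    exact hKle r hr
  calc _ ≤ ∫⁻ x, ∫⁻ y, A (r ^ (-s) / lam) * (I x * G (x - y) + I y * G (x - y)) :=
        lintegral_mono fun x => lintegral_mono fun y => tent_integrand_le hs hA hr hlam x y
    _ = A (r ^ (-s) / lam) *
          ((∫⁻ x, ∫⁻ y, I x * G (x - y)) + ∫⁻ x, ∫⁻ y, I y * G (x - y)) := by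
        rw [← lintegral_add_left (hm1.lintegral_prod_right'),
          ← lintegral_const_mul _ (by
            exact hm1.lintegral_prod_right'.add hm2.lintegral_prod_right')]
        refine lintegral_congr fun x => ?_
        rw [lintegral_const_mul _ (by fun_prop), lintegral_add_left (by fun_prop)]
    _ ≤ A (r ^ (-s) / lam) * (volume (ball (0 : Euc n) r) * ENNReal.ofReal K +
          volume (ball (0 : Euc n) r) * ENNReal.ofReal K) := by gcongr
    _ = _ := by
        congr 1
        rw [Measure.addHaar_ball_of_pos _ _ hr, finrank_euclideanSpace_fin,
          ← ENNReal.ofReal_toReal (measure_ball_lt_top (x := (0 : Euc n)) (r := 1)).ne,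
          ← ENNReal.ofReal_mul (by positivity), ← ENNReal.ofReal_mul (by positivity),
          ← ENNReal.ofReal_add (by positivity) (by positivity),
          ENNReal.toReal_ofReal (by positivity)]
        congr 1
        ring

theorem exists_rpow_le_of_campSem_le {n : ℕ} (hn : 0 < n) {s : ℝ} (hs : s ∈ Ioo (0 : ℝ) 1)
    {A : ℝ → ℝ≥0∞} (hA : IsYoung A) {c' : ℝ} (hc' : 0 < c')
    (h : ∀ u : Euc n → ℝ, Measurable u → fracSemS n s A u < ⊤ →
      campSem n (fun _ => 1) u ≤ ENNReal.ofReal c' * fracSemS n s A u) :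
    ∃ c : ℝ, 0 < c ∧ ∀ t : ℝ, 0 < t → ENNReal.ofReal (c * t ^ ((n : ℝ) / s)) ≤ A t := by
  obtain ⟨C, hC, hJ⟩ := Jfun_tent_le hn hs hA
  set lam : ℝ := (1 / 4) ^ n / 4 / (2 * c') with hlamdef
  have hlam : 0 < lam := by positivity
  have hs0 := hs.1
  refine ⟨lam ^ ((n : ℝ) / s) / C, by positivity, fun t ht => ?_⟩
  set r : ℝ := (lam * t) ^ (-(1 / s)) with hrdef
  have hr : 0 < r := by positivity
  have hrs : r ^ (-s) / lam = t := by
    rw [hrdef, ← Real.rpow_mul (by positivity), neg_mul_neg, one_div_mul_cancel hs0.ne',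
      Real.rpow_one, mul_div_cancel_left₀ _ hlam.ne']
  have hrn : r ^ n = ((lam * t) ^ ((n : ℝ) / s))⁻¹ := by
    rw [hrdef, ← Real.rpow_natCast, ← Real.rpow_mul (by positivity),
      ← Real.rpow_neg (by positivity)]
    congr 1; ring
  by_contra hlt
  rw [not_le] at hlt
  have hJ1 : Jfun n s A (fun x (_ : Fin 1) => tent n r x / lam) ≤ 1 := by
    refine (hJ r lam hr hlam).trans ?_
    rw [hrs]
    grw [hlt]
    rw [← ENNReal.ofReal_mul (by positivity), hrn, Real.mul_rpow hlam.le ht.le]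
    refine (ENNReal.ofReal_le_ofReal (le_of_eq ?_)).trans ENNReal.ofReal_one.le
    field_simp
  have hsem : fracSemS n s A (tent n r) ≤ ENNReal.ofReal lam := sInf_le ⟨lam, ⟨hlam, hJ1⟩, rfl⟩
  have h1 := h _ (continuous_tent n r).measurable (hsem.trans_lt ENNReal.ofReal_lt_top)
  have h2 : ENNReal.ofReal ((1 / 4) ^ n / 4) ≤ campSem n (fun _ => 1) (tent n r) :=
    (ENNReal.ofReal_le_ofReal (oscQuot_tent_ge hn hr)).trans
      (le_iSup_of_le 0 (le_iSup_of_le (2 * r) (le_iSup_of_le (by positivity) le_rfl)))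
  have h3 := h2.trans (h1.trans (mul_le_mul' le_rfl hsem))
  rw [← ENNReal.ofReal_mul hc'.le, ENNReal.ofReal_le_ofReal_iff (by positivity), hlamdef] at h3
  have h4 : 0 < (1 / 4 : ℝ) ^ n / 4 := by positivity
  have h5 : c' * ((1 / 4) ^ n / 4 / (2 * c')) = (1 / 4 : ℝ) ^ n / 4 / 2 := by field_simp
  linarith

/-- `V^{s,A}(ℝⁿ) → BMO(ℝⁿ)` if and only if `A(t) ≥ c t^{n/s}` for all
`t > 0` and some `c > 0`. -/
theorem stmt3 (n : ℕ) (hn : 0 < n) (s : ℝ) (hs : s ∈ Set.Ioo (0 : ℝ) 1)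
    (A : ℝ → ℝ≥0∞) (hA : IsYoung A) :
    (∃ c' : ℝ, 0 < c' ∧ ∀ u : Euc n → ℝ, Measurable u → fracSemS n s A u < ⊤ →
        campSem n (fun _ => 1) u ≤ ENNReal.ofReal c' * fracSemS n s A u) ↔
    (∃ c : ℝ, 0 < c ∧ ∀ t : ℝ, 0 < t →
        ENNReal.ofReal (c * t ^ ((n : ℝ) / s)) ≤ A t) := by
  constructor
  · rintro ⟨c', hc', h⟩
    exact exists_rpow_le_of_campSem_le hn hs hA hc' h
  · rintro ⟨c, hc, h⟩
    obtain ⟨c', hc', h'⟩ := campSem_le_of_rpow_le hn hs hc h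
    exact ⟨c', hc', fun u hu _ => h' u hu⟩
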